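/- Let G be any group and R a commutative domain such that the group of units U(RG) of the group algebra RG satisfies a Laurent polynomial identity P (with nonzero coefficient of the identity word and every non-identity word in the support of P having nonzero sum of exponents in at least one variable). Then at least one of the following holds: (i) there exists a positive integer d such that for all a, b, c in RG with a^2 = 0 and b*c = 0, the right ideal b*a*c*RG is nilpotent of exponent less than d (its d-th power is zero); or (ii) the FC-subgroup φ(G) has finite index in G and the commutator subgroup of φ(G) is finite. -/

import Mathlib

/-- The sum of exponents of the word `w` in the `i`-th variable (the `i`-th coordinate of
the image of `w` in the abelianization of the free group). -/
def expSum {l : ℕ} (i : Fin l) (w : FreeGroup (Fin l)) : ℤ :=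
  Multiplicative.toAdd
    (FreeGroup.lift (fun j => Multiplicative.ofAdd (if j = i then (1 : ℤ) else 0)) w)

/-- Evaluation of an element of the group algebra `R[F_l]` of the free group on the
units of an `R`-algebra `A`, induced by an assignment of the variables to units. -/
noncomputable def lpiEval {R : Type*} [CommRing R] {A : Type*} [Ring A] [Algebra R A]
    {l : ℕ} (u : Fin l → Aˣ) : MonoidAlgebra R (FreeGroup (Fin l)) →ₐ[R] A :=
  MonoidAlgebra.lift R A (FreeGroup (Fin l)) ((Units.coeHom A).comp (FreeGroup.lift u))

/-- The group of units of `A` satisfies the Laurent polynomial identity `P`. -/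
def SatisfiesLPI {R : Type*} [CommRing R] (A : Type*) [Ring A] [Algebra R A]
    {l : ℕ} (P : MonoidAlgebra R (FreeGroup (Fin l))) : Prop :=
  ∀ u : Fin l → Aˣ, lpiEval u P = 0

/-- A Laurent polynomial with nonzero coefficient of the identity word such that every
non-identity word in its support has nonzero sum of exponents in at least one variable. -/
def GoodLPI {R : Type*} [CommRing R] {l : ℕ}
    (P : MonoidAlgebra R (FreeGroup (Fin l))) : Prop :=
  P.coeff 1 ≠ 0 ∧ ∀ w ∈ P.coeff.support, w ≠ 1 → ∃ i : Fin l, expSum i w ≠ 0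


/-- The FC-subgroup of a group: the set of elements with finitely many conjugates. -/
def FCSubgroup (G : Type*) [Group G] : Subgroup G where
  carrier := {g | {x : G | IsConj g x}.Finite}
  one_mem' := by
    have h : {x : G | IsConj 1 x} = {1} := by
      ext x
      simp only [Set.mem_setOf_eq, Set.mem_singleton_iff]
      rw [isConj_comm]
      exact isConj_one_left
    simp only [Set.mem_setOf_eq, h]
    exact Set.finite_singleton 1
  inv_mem' := by
    intro a ha
    have hsub : {x : G | IsConj a⁻¹ x} ⊆ (fun y : G => y⁻¹) '' {x : G | IsConj a x} := by
      intro x hx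
      obtain ⟨c, hc⟩ := isConj_iff.mp hx
      refine ⟨x⁻¹, ?_, inv_inv x⟩
      exact isConj_iff.mpr ⟨c, by rw [← hc]; group⟩
    exact ((ha.image _).subset hsub)
  mul_mem' := by
    intro a b ha hb
    have hsub : {x : G | IsConj (a * b) x} ⊆
        Set.image2 (· * ·) {x : G | IsConj a x} {x : G | IsConj b x} := by
      intro x hx
      obtain ⟨c, hc⟩ := isConj_iff.mp hx
      exact ⟨c * a * c⁻¹, isConj_iff.mpr ⟨c, rfl⟩, c * b * c⁻¹, isConj_iff.mpr ⟨c, rfl⟩,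
        by rw [← hc]; group⟩
    exact ((Set.Finite.image2 _ ha hb).subset hsub)

section GroupPart

theorem bfc_finite_commutator {H : Type*} [Group H] (K : ℕ)
    (hK : ∀ g : H, {x : H | IsConj g x}.Finite ∧ {x : H | IsConj g x}.ncard ≤ K) :
    Finite (commutator H) := by
  classical
  -- pick an element with maximal class
  obtain ⟨a, ha⟩ : ∃ a : H, ∀ g : H, {x : H | IsConj g x}.ncard ≤ {x : H | IsConj a x}.ncard := by
    have hbdd : BddAbove (Set.range fun g : H => {x : H | IsConj g x}.ncard) :=
      ⟨K, by rintro _ ⟨g, rfl⟩; exact (hK g).2⟩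
    obtain ⟨a, ha⟩ := Nat.sSup_mem (Set.range_nonempty _) hbdd
    refine ⟨a, fun g => ?_⟩
    simp only at ha
    rw [ha]
    exact le_csSup hbdd ⟨g, rfl⟩
  have hfin := (hK a).1
  have hch : ∀ z : H, ∃ b : H, IsConj a z → b * a * b⁻¹ = z := by
    intro z
    by_cases h : IsConj a z
    · obtain ⟨b, hb⟩ := isConj_iff.mp h
      exact ⟨b, fun _ => hb⟩
    · exact ⟨1, fun h' => absurd h' h⟩
  choose b hb using hch
  -- the finite index subgroup C
  have hcent : ∀ g : H, (Subgroup.centralizer {g}).FiniteIndex := by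
    intro g
    have h1 := (hK g).1
    have : Finite (H ⧸ Subgroup.centralizer {g}) := by
      have : Finite {x : H | IsConj g x} := h1
      refine Finite.of_injective (β := {x : H | IsConj g x})
        (fun q => Quotient.liftOn' q (fun y => ⟨y * g * y⁻¹, isConj_iff.mpr ⟨y, rfl⟩⟩) ?_) ?_
      · intro y z hyz
        rw [QuotientGroup.leftRel_apply, Subgroup.mem_centralizer_singleton_iff] at hyz
        simp only [Subtype.mk.injEq]
        have : z * g = y * (y⁻¹ * z * g) := by group
        rw [this, hyz]; group
      · intro q r
        refine Quotient.inductionOn₂' q r ?_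
        intro y z h
        simp only [Quotient.liftOn'_mk'', Subtype.mk.injEq] at h
        apply Quotient.sound'
        rw [QuotientGroup.leftRel_apply, Subgroup.mem_centralizer_singleton_iff]
        have : z * g = y * g * y⁻¹ * z := by rw [h]; group
        calc y⁻¹ * z * g = y⁻¹ * (z * g) := by group
          _ = g * (y⁻¹ * z) := by rw [this]; group
    exact Subgroup.finiteIndex_of_finite_quotient
  let C : Subgroup H := ⨅ z : hfin.toFinset, Subgroup.centralizer {b z}
  haveI : C.FiniteIndex := Subgroup.finiteIndex_iInf (fun i => hcent _)
  have hC : ∀ u ∈ C, ∀ z, IsConj a z → u * b z = b z * u := by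
    intro u hu z hz
    have := (Subgroup.mem_iInf.mp hu) ⟨z, hfin.mem_toFinset.mpr hz⟩
    rw [Subgroup.mem_centralizer_singleton_iff] at this
    exact this
  set A : Set H := {x : H | IsConj a x} with hA
  let E : Set H := Set.image2 (fun s t => s * t⁻¹) A A
  have hE : E.Finite := hfin.image2 _ hfin
  have key : ∀ u ∈ C, ∀ y : H, u⁻¹ * (y * u * y⁻¹) ∈ E := by
    intro u hu y
    have himg : (fun z => u * z) '' A ⊆ {x : H | IsConj (u * a) x} := by
      rintro _ ⟨z, hz, rfl⟩
      refine isConj_iff.mpr ⟨b z, ?_⟩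
      have := hC u hu z hz
      calc b z * (u * a) * (b z)⁻¹ = (b z * u) * a * (b z)⁻¹ := by group
        _ = u * (b z * a * (b z)⁻¹) := by rw [← this]; group
        _ = u * z := by rw [hb z hz]
    have heq : (fun z => u * z) '' A = {x : H | IsConj (u * a) x} := by
      refine Set.eq_of_subset_of_ncard_le himg ?_ (hK _).1
      rw [Set.ncard_image_of_injective _ (mul_right_injective u)]
      exact ha _
    have hm : y * (u * a) * y⁻¹ ∈ {x : H | IsConj (u * a) x} := isConj_iff.mpr ⟨y, rfl⟩
    rw [← heq] at hm
    obtain ⟨z, hz, hzz⟩ := hm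
    refine ⟨z, hz, y * a * y⁻¹, isConj_iff.mpr ⟨y, rfl⟩, ?_⟩
    simp only at hzz ⊢
    have : z = u⁻¹ * (y * (u * a) * y⁻¹) := by rw [← hzz]; group
    rw [this]; group
  -- now commutatorSet is finite
  have hcs : (commutatorSet H).Finite := by
    have hq : Finite (H ⧸ C) := Subgroup.finite_quotient_of_finiteIndex
    let T : Set H := Set.range (fun q : H ⧸ C => (Quotient.out q)⁻¹)
    have hT : T.Finite := Set.finite_range _
    let B : Set H := ⋃ c ∈ T, {x : H | IsConj c x}
    have hB : B.Finite := hT.biUnion (fun c _ => (hK c).1)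
    have hfin2 : (Set.image2 (fun p q : H => p * q)
        (Set.image2 (fun c s : H => c⁻¹ * s) T E) B).Finite :=
      (hT.image2 _ hE).image2 _ hB
    refine (hfin2.image (fun x => x⁻¹)).subset ?_ |>.subset (Set.Subset.refl _)
    rintro _ ⟨y, h, rfl⟩
    -- ⁅y,h⁆ = y h y⁻¹ h⁻¹ ; use inverse: h y h⁻¹ y⁻¹
    obtain ⟨u, hu, c, hc, hhc⟩ : ∃ u ∈ C, ∃ c ∈ T, h⁻¹ = u * c := by
      refine ⟨h⁻¹ * Quotient.out (QuotientGroup.mk h : H ⧸ C), ?_,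
        (Quotient.out (QuotientGroup.mk h : H ⧸ C))⁻¹, ⟨_, rfl⟩, by group⟩
      have := QuotientGroup.mk_out_eq_mul C h
      obtain ⟨k, hk⟩ := this
      rw [hk]; simp
    refine ⟨c⁻¹ * (u⁻¹ * (y * u * y⁻¹)) * (y * c * y⁻¹),
      ⟨_, ⟨c, hc, _, key u hu y, rfl⟩, y * c * y⁻¹, ?_, rfl⟩, ?_⟩
    · exact Set.mem_biUnion hc (isConj_iff.mpr ⟨y, rfl⟩)
    · have : h = c⁻¹ * u⁻¹ := by rw [← inv_inv h, hhc]; group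
      simp only [commutatorElement_def]
      rw [this]; group
  have : Finite (commutatorSet H) := hcs
  infer_instance

theorem fc_of_cover {G : Type*} [Group G] (k : ℕ) (T : Finset G)
    (hcov : ∀ g : G, ∃ t ∈ T, {x : G | IsConj (t⁻¹ * g) x}.Finite ∧
      {x : G | IsConj (t⁻¹ * g) x}.ncard ≤ k) :
    (FCSubgroup G).FiniteIndex ∧ Finite (commutator ↥(FCSubgroup G)) := by
  classical
  constructor
  · have : Finite (G ⧸ FCSubgroup G) := by
      refine Finite.of_surjective (α := T) (fun t => (QuotientGroup.mk (t : G) : G ⧸ FCSubgroup G)) ?_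
      intro q
      induction q using QuotientGroup.induction_on with
      | _ g =>
        obtain ⟨t, ht, h1, _⟩ := hcov g
        refine ⟨⟨t, ht⟩, ?_⟩
        rw [QuotientGroup.eq]
        exact h1
    exact Subgroup.finiteIndex_of_finite_quotient
  · let M : ℕ := T.sup (fun t => {x : G | IsConj t x}.ncard)
    refine bfc_finite_commutator (M * k) ?_
    intro d
    obtain ⟨t, ht, h1, h2⟩ := hcov d
    have htd : t ∈ FCSubgroup G := by
      have h3 : t⁻¹ * (d : G) ∈ FCSubgroup G := h1
      have h4 := (FCSubgroup G).mul_mem d.2 ((FCSubgroup G).inv_mem h3)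
      simpa using h4
    have htf : {x : G | IsConj t x}.Finite := htd
    have hsub : (Subtype.val '' {x : FCSubgroup G | IsConj d x}) ⊆
        Set.image2 (· * ·) {x : G | IsConj t x} {x : G | IsConj (t⁻¹ * (d : G)) x} := by
      rintro _ ⟨x, hx, rfl⟩
      obtain ⟨c, rfl⟩ := isConj_iff.mp hx
      refine ⟨c * t * (c : G)⁻¹, isConj_iff.mpr ⟨c, rfl⟩, c * (t⁻¹ * d) * (c : G)⁻¹,
        isConj_iff.mpr ⟨c, rfl⟩, ?_⟩
      simp only [Subgroup.coe_mul, InvMemClass.coe_inv]; group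
    have hf := htf.image2 (· * ·) h1
    refine ⟨Set.Finite.of_finite_image (hf.subset hsub) Subtype.val_injective.injOn, ?_⟩
    rw [← Set.ncard_image_of_injective _ Subtype.val_injective]
    refine (Set.ncard_le_ncard hsub hf).trans ?_
    rw [← Set.image_prod]
    refine (Set.ncard_image_le (htf.prod h1)).trans ?_
    rw [Set.ncard_prod]
    exact Nat.mul_le_mul (Finset.le_sup (f := fun t => {x : G | IsConj t x}.ncard) ht) h2

end GroupPart
section GermPart

open Filter

theorem germ_not_fc {G : Type*} [Group G] (f : ℕ → G)
    (hf : ∀ k, ¬ ({x : G | IsConj (f k) x}.Finite ∧ {x : G | IsConj (f k) x}.ncard ≤ k)) :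
    ((f : (hyperfilter ℕ : Filter ℕ).Germ G)) ∉ FCSubgroup ((hyperfilter ℕ : Filter ℕ).Germ G) := by
  classical
  intro hmem
  have hfin : {x : (hyperfilter ℕ : Filter ℕ).Germ G | IsConj (f : (hyperfilter ℕ : Filter ℕ).Germ G) x}.Finite := hmem
  set m := hfin.toFinset.card with hm
  have hinj : ∀ k, ∃ c : Fin (m + 1) → G, m ≤ k → Function.Injective fun i => c i * f k * (c i)⁻¹ := by
    intro k
    by_cases hk : m ≤ k
    swap
    · exact ⟨fun _ => 1, fun h => absurd h hk⟩
    have : ∃ t : Finset G, (t : Set G) ⊆ {x : G | IsConj (f k) x} ∧ t.card = m + 1 := by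
      by_cases hF : {x : G | IsConj (f k) x}.Finite
      · have h2 : k < {x : G | IsConj (f k) x}.ncard := by
          by_contra h
          exact hf k ⟨hF, not_lt.mp h⟩
        rw [Set.ncard_eq_toFinset_card _ hF] at h2
        obtain ⟨t, ht, htc⟩ := Finset.exists_subset_card_eq (s := hF.toFinset) (n := m + 1) (by omega)
        exact ⟨t, fun x hx => hF.mem_toFinset.mp (ht hx), htc⟩
      · exact Set.Infinite.exists_subset_card_eq hF (m + 1)
    obtain ⟨t, ht, htc⟩ := this
    let e : Fin (m + 1) ≃ t := (Fintype.equivFinOfCardEq (by simp [htc])).symm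
    have hc : ∀ i : Fin (m + 1), ∃ c, c * f k * c⁻¹ = (e i : G) := fun i =>
      isConj_iff.mp (ht (e i).2)
    choose c hc using hc
    refine ⟨c, fun _ i j hij => ?_⟩
    simp only [hc] at hij
    exact e.injective (Subtype.ext hij)
  choose c hc using hinj
  let F : Fin (m + 1) → hfin.toFinset := fun i =>
    ⟨(((fun k => c k i * f k * (c k i)⁻¹ : ℕ → G)) : (hyperfilter ℕ : Filter ℕ).Germ G), by
      rw [Set.Finite.mem_toFinset]
      exact isConj_iff.mpr ⟨((fun k => c k i : ℕ → G) : (hyperfilter ℕ : Filter ℕ).Germ G), rfl⟩⟩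
  have hFi : Function.Injective F := by
    intro i j hij
    have h1 := congrArg Subtype.val hij
    simp only [F] at h1
    have h2 := Germ.coe_eq.mp h1
    have h3 : ∀ᶠ k in (hyperfilter ℕ : Filter ℕ), m ≤ k := by
      have : ∀ᶠ k : ℕ in atTop, m ≤ k := eventually_ge_atTop m
      rw [← Nat.cofinite_eq_atTop] at this
      exact this.filter_mono hyperfilter_le_cofinite
    obtain ⟨k, hk1, hk2⟩ := (h2.and h3).exists
    exact hc k hk2 hk1
  have := Fintype.card_le_of_injective F hFi
  rw [Fintype.card_coe, Fintype.card_fin] at this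
  omega

theorem cover_of_germ {G : Type*} [Group G]
    (h : (FCSubgroup ((hyperfilter ℕ : Filter ℕ).Germ G)).FiniteIndex) :
    ∃ (k : ℕ) (T : Finset G), ∀ g : G, ∃ t ∈ T, {x : G | IsConj (t⁻¹ * g) x}.Finite ∧
      {x : G | IsConj (t⁻¹ * g) x}.ncard ≤ k := by
  classical
  by_contra hcon
  push Not at hcon
  have hs : ∀ k : ℕ, ∃ s : ℕ → G, ∀ i j, i < j →
      ¬ ({x : G | IsConj ((s i)⁻¹ * s j) x}.Finite ∧ {x : G | IsConj ((s i)⁻¹ * s j) x}.ncard ≤ k) := by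
    intro k
    obtain ⟨s, -, hs⟩ := exists_seq_of_forall_finset_exists (fun _ : G => True)
      (fun x y => ¬ ({z : G | IsConj (x⁻¹ * y) z}.Finite ∧ {z : G | IsConj (x⁻¹ * y) z}.ncard ≤ k))
      (fun T _ => by
        obtain ⟨g, hg⟩ := hcon k T
        exact ⟨g, trivial, fun t ht ⟨h1, h2⟩ => absurd h2 (not_le.mpr (hg t ht h1))⟩)
    exact ⟨s, hs⟩
  choose s hs using hs
  let q : ℕ → ((hyperfilter ℕ : Filter ℕ).Germ G) ⧸ FCSubgroup ((hyperfilter ℕ : Filter ℕ).Germ G) :=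
    fun j => QuotientGroup.mk (((fun k => s k j : ℕ → G)) : (hyperfilter ℕ : Filter ℕ).Germ G)
  have hlt : ∀ i j, i < j → q i ≠ q j := by
    intro i j hij heq
    rw [QuotientGroup.eq] at heq
    exact germ_not_fc (fun k => (s k i)⁻¹ * s k j) (fun k => hs k i j hij) heq
  have hq : Function.Injective q := by
    intro i j hij
    rcases lt_trichotomy i j with h1 | h1 | h1
    · exact absurd hij (hlt i j h1)
    · exact h1
    · exact absurd hij.symm (hlt j i h1)
  have : Finite (((hyperfilter ℕ : Filter ℕ).Germ G) ⧸ FCSubgroup ((hyperfilter ℕ : Filter ℕ).Germ G)) :=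
    Subgroup.finite_quotient_of_finiteIndex
  exact not_injective_infinite_finite q hq

end GermPart
section DeltaPart

open Filter Pointwise

theorem centralizer_fi_of_fc {H : Type*} [Group H] {g : H} (h1 : {x : H | IsConj g x}.Finite) :
    (Subgroup.centralizer {g}).FiniteIndex := by
  have : Finite (H ⧸ Subgroup.centralizer {g}) := by
    have : Finite {x : H | IsConj g x} := h1
    refine Finite.of_injective (β := {x : H | IsConj g x})
      (fun q => Quotient.liftOn' q (fun y => ⟨y * g * y⁻¹, isConj_iff.mpr ⟨y, rfl⟩⟩) ?_) ?_
    · intro y z hyz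
      rw [QuotientGroup.leftRel_apply, Subgroup.mem_centralizer_singleton_iff] at hyz
      simp only [Subtype.mk.injEq]
      have : z * g = y * (y⁻¹ * z * g) := by group
      rw [this, hyz]; group
    · intro q r
      refine Quotient.inductionOn₂' q r ?_
      intro y z h
      simp only [Quotient.liftOn'_mk'', Subtype.mk.injEq] at h
      apply Quotient.sound'
      rw [QuotientGroup.leftRel_apply, Subgroup.mem_centralizer_singleton_iff]
      have : z * g = y * g * y⁻¹ * z := by rw [h]; group
      calc y⁻¹ * z * g = y⁻¹ * (z * g) := by group
        _ = g * (y⁻¹ * z) := by rw [this]; group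
  exact Subgroup.finiteIndex_of_finite_quotient

theorem fc_of_centralizer_fi {H : Type*} [Group H] {g : H}
    (h1 : (Subgroup.centralizer {g}).FiniteIndex) : g ∈ FCSubgroup H := by
  have : Finite (H ⧸ Subgroup.centralizer {g}) := Subgroup.finite_quotient_of_finiteIndex
  have hf : (Set.range (fun q : H ⧸ Subgroup.centralizer {g} =>
    Quotient.out q * g * (Quotient.out q)⁻¹)).Finite := Set.finite_range _
  refine hf.subset ?_
  intro x hx
  obtain ⟨c, rfl⟩ := isConj_iff.mp hx
  refine ⟨QuotientGroup.mk c, ?_⟩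
  obtain ⟨k, hk⟩ := QuotientGroup.mk_out_eq_mul (Subgroup.centralizer {g}) c
  simp only
  rw [hk]
  have := Subgroup.mem_centralizer_singleton_iff.mp k.2
  calc c * (k : H) * g * (c * (k : H))⁻¹ = c * ((k : H) * g) * (k : H)⁻¹ * c⁻¹ := by group
    _ = c * g * c⁻¹ := by rw [this]; group

instance fcNormal (G : Type*) [Group G] : (FCSubgroup G).Normal where
  conj_mem := by
    intro n hn g
    have hn' : {x : G | IsConj n x}.Finite := hn
    refine hn'.subset ?_
    intro x hx
    exact (isConj_iff.mpr ⟨g, rfl⟩ : IsConj n (g * n * g⁻¹)).trans hx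

/-- Small sets: covered by finitely many cosets of subgroups of infinite index. -/
def SmallSet {G : Type*} [Group G] (S : Set G) : Prop :=
  ∃ s : Finset (G × Subgroup G), (∀ c ∈ s, ¬ c.2.FiniteIndex) ∧
    S ⊆ ⋃ c ∈ s, c.1 • (c.2 : Set G)

theorem SmallSet.union {G : Type*} [Group G] {S T : Set G} (hS : SmallSet S) (hT : SmallSet T) :
    SmallSet (S ∪ T) := by
  classical
  obtain ⟨s, hs, hs'⟩ := hS
  obtain ⟨t, ht, ht'⟩ := hT
  refine ⟨s ∪ t, ?_, ?_⟩
  · intro c hc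
    rcases Finset.mem_union.mp hc with h | h
    · exact hs c h
    · exact ht c h
  · rw [Finset.set_biUnion_union]
    exact Set.union_subset_union hs' ht'

theorem SmallSet.mono {G : Type*} [Group G] {S T : Set G} (hT : SmallSet T) (h : S ⊆ T) :
    SmallSet S := by
  obtain ⟨t, ht, ht'⟩ := hT
  exact ⟨t, ht, h.trans ht'⟩

theorem SmallSet.empty {G : Type*} [Group G] : SmallSet (∅ : Set G) :=
  ⟨∅, by simp, by simp⟩

theorem SmallSet.coset {G : Type*} [Group G] (g : G) {H : Subgroup G} (hH : ¬ H.FiniteIndex) :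
    SmallSet (g • (H : Set G)) :=
  ⟨{(g, H)}, by simpa using hH, by simp⟩

theorem SmallSet.smul {G : Type*} [Group G] {S : Set G} (g : G) (hS : SmallSet S) :
    SmallSet (g • S) := by
  classical
  obtain ⟨s, hs, hs'⟩ := hS
  refine ⟨s.image (fun c => (g * c.1, c.2)), ?_, ?_⟩
  · intro c hc
    obtain ⟨d, hd, rfl⟩ := Finset.mem_image.mp hc
    exact hs d hd
  · rintro _ ⟨x, hx, rfl⟩
    have := hs' hx
    simp only [Set.mem_iUnion] at this ⊢
    obtain ⟨c, hc, hxc⟩ := this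
    refine ⟨(g * c.1, c.2), Finset.mem_image.mpr ⟨c, hc, rfl⟩, ?_⟩
    simp only [mul_smul]
    exact Set.smul_mem_smul_set hxc

theorem not_smallSet_univ {G : Type*} [Group G] : ¬ SmallSet (Set.univ : Set G) := by
  rintro ⟨s, hs, hs'⟩
  obtain ⟨k, hk, hk'⟩ := Subgroup.exists_finiteIndex_of_leftCoset_cover
    (H := fun c : G × Subgroup G => c.2) (g := fun c => c.1) (s := s) (Set.univ_subset_iff.mp hs')
  exact hs k hk hk'

theorem not_smallSet_fi {G : Type*} [Group G] (W : Subgroup G) [W.FiniteIndex] :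
    ¬ SmallSet (W : Set G) := by
  classical
  intro h
  have : Finite (G ⧸ W) := Subgroup.finite_quotient_of_finiteIndex
  have hf : ∀ t : Finset (G ⧸ W), SmallSet (⋃ q ∈ t, (Quotient.out q) • (W : Set G)) := by
    intro t
    induction t using Finset.induction_on with
    | empty => simpa using SmallSet.empty
    | insert a t _ ih =>
      rw [Finset.set_biUnion_insert]
      exact (h.smul _).union ih
  have := Fintype.ofFinite (G ⧸ W)
  refine not_smallSet_univ ((hf Finset.univ).mono ?_)
  intro g _
  simp only [Set.mem_iUnion]
  refine ⟨QuotientGroup.mk g, Finset.mem_univ _, ?_⟩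
  rw [mem_leftCoset_iff]
  obtain ⟨k, hk⟩ := QuotientGroup.mk_out_eq_mul W g
  rw [hk]
  simp

/-- The filter of co-small sets. -/
def coSmall (G : Type*) [Group G] : Filter G :=
  Filter.comk SmallSet SmallSet.empty (fun _ ht _ h => ht.mono h) (fun _ hs _ ht => hs.union ht)

theorem eventually_coSmall {G : Type*} [Group G] {p : G → Prop} :
    (∀ᶠ g in coSmall G, p g) ↔ SmallSet {g | ¬ p g} := Iff.rfl

theorem coSmall_translate {G : Type*} [Group G] {p : G → Prop} (s : G)
    (h : ∀ᶠ g in coSmall G, p g) : ∀ᶠ g in coSmall G, p (s * g) := by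
  rw [eventually_coSmall] at h ⊢
  refine (h.smul s⁻¹).mono ?_
  intro g hg
  rw [Set.mem_smul_set_iff_inv_smul_mem]
  simpa using hg

theorem coSmall_exists_fi {G : Type*} [Group G] {p : G → Prop} (W : Subgroup G) [W.FiniteIndex]
    (h : ∀ᶠ g in coSmall G, p g) : ∃ g ∈ W, p g := by
  by_contra hcon
  push Not at hcon
  rw [eventually_coSmall] at h
  exact not_smallSet_fi W (h.mono fun g hg => hcon g hg)

theorem coSmall_conj_ne {G : Type*} [Group G] {p : G} (hp : p ∉ FCSubgroup G) (c : G) :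
    ∀ᶠ g in coSmall G, g⁻¹ * p * g ≠ c := by
  rw [eventually_coSmall]
  by_cases hex : ∃ g0, g0⁻¹ * p * g0 = c
  · obtain ⟨g0, hg0⟩ := hex
    have hc : ¬ (Subgroup.centralizer {c}).FiniteIndex := by
      intro h
      apply hp
      have h1 := (fcNormal G).conj_mem c (fc_of_centralizer_fi h) g0
      rw [← hg0] at h1
      convert h1 using 1
      group
    refine (SmallSet.coset g0 hc).mono ?_
    intro g hg
    simp only [Set.mem_setOf_eq, not_not] at hg
    rw [mem_leftCoset_iff, SetLike.mem_coe, Subgroup.mem_centralizer_singleton_iff]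
    have h1 : p * g = g * c := by rw [← hg]; group
    have h2 : p = g0 * c * g0⁻¹ := by rw [← hg0]; group
    calc g0⁻¹ * g * c = g0⁻¹ * (g * c) := by group
      _ = c * (g0⁻¹ * g) := by rw [← h1, h2]; group
  · push Not at hex
    exact SmallSet.empty.mono (fun g hg => absurd (hex g) hg)

theorem coSmall_mul_notin {G : Type*} [Group G] (hG : ¬ (FCSubgroup G).FiniteIndex) (p q : G) :
    ∀ᶠ g in coSmall G, p * g * q ∉ FCSubgroup G := by
  rw [eventually_coSmall]
  refine (SmallSet.coset (p⁻¹ * q⁻¹) hG).mono ?_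
  intro g hg
  simp only [Set.mem_setOf_eq, not_not] at hg
  rw [mem_leftCoset_iff, SetLike.mem_coe]
  have := (fcNormal G).conj_mem _ hg q
  convert this using 1
  group

end DeltaPart
section ThetaPart

open Filter MonoidAlgebra

variable {R : Type*} [CommRing R] {G : Type*} [Group G]

open Classical in
/-- The projection of the group algebra on the elements supported in `D`. -/
noncomputable def thetaProj (D : Subgroup G) (z : MonoidAlgebra R G) : MonoidAlgebra R G :=
  MonoidAlgebra.ofCoeff (z.coeff.filter (fun g => g ∈ D))

open Classical in
theorem thetaProj_coeff (D : Subgroup G) (z : MonoidAlgebra R G) (g : G) :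
    (thetaProj D z).coeff g = if g ∈ D then z.coeff g else 0 := by
  simp [thetaProj, Finsupp.filter_apply]

theorem ext_coeff {x y : MonoidAlgebra R G} (h : ∀ g, x.coeff g = y.coeff g) : x = y := by
  apply MonoidAlgebra.coeff_injective
  exact Finsupp.ext h

theorem coeff_single_mul' (t : G) (z : MonoidAlgebra R G) (g : G) :
    (single t (1 : R) * z).coeff g = z.coeff (t⁻¹ * g) := by
  rw [coeff_single_mul_apply, one_mul]

theorem mul_eq_zero_of_theta (D : Subgroup G) (w : MonoidAlgebra R G) :
    ∀ (n : ℕ) (z : MonoidAlgebra R G), z.coeff.support.card = n →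
      (∀ t : G, thetaProj D (single t 1 * z) * w = 0) → z * w = 0 := by
  classical
  intro n
  induction n using Nat.strong_induction_on with
  | _ n ih =>
    intro z hz h
    by_cases hz0 : z = 0
    · simp [hz0]
    have : z.coeff.support.Nonempty := by
      rw [Finsupp.support_nonempty_iff]
      simpa using hz0
    obtain ⟨a, ha⟩ := this
    set z1 := single a (1 : R) * thetaProj D (single a⁻¹ 1 * z) with hz1
    have hz1c : ∀ g, z1.coeff g = if a⁻¹ * g ∈ D then z.coeff g else 0 := by
      intro g
      rw [hz1, coeff_single_mul', thetaProj_coeff, coeff_single_mul']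
      simp
    have hz1w : z1 * w = 0 := by rw [hz1, mul_assoc, h, mul_zero]
    set z2 := z - z1 with hz2
    have hz2c : ∀ g, z2.coeff g = if a⁻¹ * g ∈ D then 0 else z.coeff g := by
      intro g
      rw [hz2, coeff_sub, Finsupp.sub_apply, hz1c]
      split_ifs <;> simp
    have hcard : z2.coeff.support.card < n := by
      rw [← hz]
      apply Finset.card_lt_card
      refine ⟨?_, fun hsub => ?_⟩
      · intro g hg
        rw [Finsupp.mem_support_iff, hz2c] at hg
        rw [Finsupp.mem_support_iff]
        split_ifs at hg with h1
        · exact absurd rfl hg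
        · exact hg
      · have := hsub ha
        rw [Finsupp.mem_support_iff, hz2c] at this
        simp at this
    have h2 : z2 * w = 0 := by
      refine ih _ hcard z2 rfl ?_
      intro t
      by_cases hta : a⁻¹ * t⁻¹ ∈ D
      · have : thetaProj D (single t 1 * z2) = 0 := by
          apply ext_coeff
          intro g
          rw [thetaProj_coeff, coeff_single_mul', hz2c]
          split_ifs with h1 h3
          · rfl
          · exfalso
            apply h3
            have := D.mul_mem hta h1
            rwa [mul_assoc] at this
          · rfl
        rw [this, zero_mul]
      · have : thetaProj D (single t 1 * z2) = thetaProj D (single t 1 * z) := by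
          apply ext_coeff
          intro g
          rw [thetaProj_coeff, thetaProj_coeff, coeff_single_mul', coeff_single_mul', hz2c]
          split_ifs with h1 h3
          · exfalso
            apply hta
            have := D.mul_mem h3 (D.inv_mem h1)
            convert this using 1
            group
          · rfl
          · rfl
        rw [this, h t]
    have : z = z1 + z2 := by rw [hz2]; abel
    rw [this, add_mul, hz1w, h2, add_zero]

/-- Elements supported in the set `N`. -/
def SuppIn (N : Set G) (a : MonoidAlgebra R G) : Prop := ∀ g, a.coeff g ≠ 0 → g ∈ N

theorem SuppIn.mul {N M K : Set G} {a b : MonoidAlgebra R G} (ha : SuppIn N a) (hb : SuppIn M b)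
    (h : ∀ p ∈ N, ∀ q ∈ M, p * q ∈ K) : SuppIn K (a * b) := by
  classical
  intro g hg
  have := support_coeff_mul_subset a b (Finsupp.mem_support_iff.mpr hg)
  obtain ⟨p, hp, q, hq, rfl⟩ := Finset.mem_mul.mp this
  exact h p (ha p (Finsupp.mem_support_iff.mp hp)) q (hb q (Finsupp.mem_support_iff.mp hq))

theorem SuppIn.single (s : G) : SuppIn ({s} : Set G) (single s (1 : R)) := by
  classical
  intro g hg
  rw [coeff_single_apply] at hg
  split_ifs at hg with h
  · exact h.symm
  · exact absurd rfl hg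

theorem SuppIn.mono {N M : Set G} {a : MonoidAlgebra R G} (ha : SuppIn N a) (h : N ⊆ M) :
    SuppIn M a := fun g hg => h (ha g hg)

theorem suppIn_self (a : MonoidAlgebra R G) : SuppIn (a.coeff.support : Set G) a :=
  fun _ hg => Finsupp.mem_support_iff.mpr hg

/-- Generalized linear forms with left coefficients supported in `N`. -/
def LinForm (N : Set G) (f : G → MonoidAlgebra R G) : Prop :=
  ∃ l : List (MonoidAlgebra R G × MonoidAlgebra R G), (∀ p ∈ l, SuppIn N p.1) ∧
    ∀ g, f g = (l.map (fun p => p.1 * single g (1 : R) * p.2)).sum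

theorem LinForm.zero (N : Set G) : LinForm N (fun _ => (0 : MonoidAlgebra R G)) :=
  ⟨[], by simp, by simp⟩

theorem LinForm.add {N : Set G} {f1 f2 : G → MonoidAlgebra R G} (h1 : LinForm N f1)
    (h2 : LinForm N f2) : LinForm N (fun g => f1 g + f2 g) := by
  obtain ⟨l1, hl1, h1⟩ := h1
  obtain ⟨l2, hl2, h2⟩ := h2
  refine ⟨l1 ++ l2, ?_, ?_⟩
  · intro p hp
    rcases List.mem_append.mp hp with h | h
    · exact hl1 p h
    · exact hl2 p h
  · intro g
    show f1 g + f2 g = _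
    rw [List.map_append, List.sum_append, h1, h2]

theorem LinForm.sum {ι : Type*} {N : Set G} (s : Finset ι) (f : ι → G → MonoidAlgebra R G)
    (h : ∀ i ∈ s, LinForm N (f i)) : LinForm N (fun g => ∑ i ∈ s, f i g) := by
  classical
  induction s using Finset.induction_on with
  | empty => simpa using LinForm.zero N
  | insert a s ha ih =>
    simp only [Finset.sum_insert ha]
    exact (h a (Finset.mem_insert_self a s)).add
      (ih fun i hi => h i (Finset.mem_insert_of_mem hi))

theorem LinForm.basic {N : Set G} {a : MonoidAlgebra R G} (ha : SuppIn N a)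
    (b : MonoidAlgebra R G) : LinForm N (fun g => a * single g (1 : R) * b) :=
  ⟨[(a, b)], by simpa using ha, by simp⟩

theorem LinForm.mul_left {N M K : Set G} {f : G → MonoidAlgebra R G} (h : LinForm N f)
    {a : MonoidAlgebra R G} (ha : SuppIn M a) (hK : ∀ p ∈ M, ∀ q ∈ N, p * q ∈ K) :
    LinForm K (fun g => a * f g) := by
  obtain ⟨l, hl, h⟩ := h
  refine ⟨l.map (fun p => (a * p.1, p.2)), ?_, ?_⟩
  · intro p hp
    obtain ⟨q, hq, rfl⟩ := List.mem_map.mp hp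
    exact ha.mul (hl q hq) hK
  · intro g
    show a * f g = _
    rw [h g, ← List.sum_map_mul_left, List.map_map]
    congr 1
    apply List.map_congr_left
    intro p _
    simp only [Function.comp, mul_assoc]

theorem LinForm.translate {N K : Set G} {f : G → MonoidAlgebra R G} (h : LinForm N f)
    (s : G) (hK : ∀ p ∈ N, p * s ∈ K) :
    LinForm K (fun g => f (s * g)) := by
  obtain ⟨l, hl, h⟩ := h
  refine ⟨l.map (fun p => (p.1 * single s (1 : R), p.2)), ?_, ?_⟩
  · intro p hp
    obtain ⟨q, hq, rfl⟩ := List.mem_map.mp hp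
    refine (hl q hq).mul (SuppIn.single s) ?_
    intro p' hp' q' hq'
    rw [Set.mem_singleton_iff.mp hq']
    exact hK p' hp'
  · intro g
    show f (s * g) = _
    rw [h (s * g), List.map_map]
    congr 1
    apply List.map_congr_left
    intro p _
    have : single (s * g) (1 : R) = single s 1 * single g 1 := by
      rw [single_mul_single, one_mul]
    simp only [Function.comp, mul_assoc, this]

/-- The Delta-lemma. -/
theorem delta_lemma {N : Set G} (hN : ∀ g ∈ N, g ∉ FCSubgroup G) (α β : MonoidAlgebra R G)
    {f : G → MonoidAlgebra R G} (hf : LinForm N f)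
    (h : ∀ᶠ g in coSmall G, α * single g (1 : R) * β + f g = 0) :
    thetaProj (FCSubgroup G) α * β = 0 := by
  classical
  set α1 := thetaProj (FCSubgroup G) α with hα1
  have hα2 : SuppIn {g | g ∉ FCSubgroup G} (α - α1) := by
    intro g hg
    rw [coeff_sub, Finsupp.sub_apply, hα1, thetaProj_coeff] at hg
    intro h1
    simp [h1] at hg
  -- absorb the complement in the linear form
  obtain ⟨l, hl, hlf⟩ : LinForm {g | g ∉ FCSubgroup G}
      (fun g => (α - α1) * single g (1 : R) * β + f g) := by
    refine (LinForm.basic hα2 β).add ?_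
    obtain ⟨l, hl, hlf⟩ := hf
    exact ⟨l, fun p hp => (hl p hp).mono (fun g hg => hN g hg), hlf⟩
  have h' : ∀ᶠ g in coSmall G, α1 * single g (1 : R) * β +
      (l.map (fun p => p.1 * single g (1 : R) * p.2)).sum = 0 := by
    filter_upwards [h] with g hg
    rw [← hlf, ← hg]
    show α1 * single g (1 : R) * β + ((α - α1) * single g (1 : R) * β + f g) = _
    rw [sub_mul, sub_mul]
    abel
  by_contra hne
  obtain ⟨z, hz⟩ : ∃ z, (α1 * β).coeff z ≠ 0 := by
    by_contra hcon
    push Not at hcon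
    exact hne (ext_coeff hcon)
  let W : Subgroup G := ⨅ a : α1.coeff.support, Subgroup.centralizer {(a : G)}
  have : W.FiniteIndex := by
    refine Subgroup.finiteIndex_iInf (fun a => centralizer_fi_of_fc ?_)
    have ha := Finsupp.mem_support_iff.mp a.2
    have hc := thetaProj_coeff (FCSubgroup G) α (a : G)
    by_contra hcon
    exact ha (hc.trans (if_neg hcon))
  have hav : ∀ᶠ g in coSmall G, ∀ p ∈ {p | p ∈ l}, ∀ a ∈ p.1.coeff.support, ∀ b ∈ p.2.coeff.support,
      g⁻¹ * a * g ≠ z * b⁻¹ := by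
    rw [Filter.eventually_all_finite (List.finite_toSet l)]
    intro p hp
    rw [Filter.eventually_all_finset]
    intro a ha
    rw [Filter.eventually_all_finset]
    intro b _
    exact coSmall_conj_ne (hl p hp a (Finsupp.mem_support_iff.mp ha)) _
  obtain ⟨g, hgW, hg1, hg2⟩ := coSmall_exists_fi W (h'.and hav)
  have hcomm : single g⁻¹ (1 : R) * α1 * single g 1 = α1 := by
    apply ext_coeff
    intro k
    rw [coeff_mul_single_apply, mul_one, coeff_single_mul']
    have hinf : ∀ a, α1.coeff a ≠ 0 → g * a = a * g := by
      intro a ha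
      have := (Subgroup.mem_iInf.mp hgW) ⟨a, Finsupp.mem_support_iff.mpr ha⟩
      exact Subgroup.mem_centralizer_singleton_iff.mp this
    rw [inv_inv]
    by_cases hk : α1.coeff k = 0
    · by_cases hk2 : α1.coeff (g * (k * g⁻¹)) = 0
      · rw [hk, hk2]
      · have := hinf _ hk2
        exfalso
        apply hk2
        have h3 : k = g * (k * g⁻¹) := by
          have h4 : k * g⁻¹ * g = g * (k * g⁻¹) := by
            have h5 : g⁻¹ * (g * (g * (k * g⁻¹))) = g⁻¹ * (g * (k * g⁻¹) * g) := by rw [this]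
            simpa [mul_assoc] using h5.symm
          simpa using h4
        rw [← h3, hk]
    · have := hinf k hk
      congr 1
      rw [← mul_assoc, this]; group
  have hcon := congrArg (fun y => (single g⁻¹ (1 : R) * y).coeff z) hg1
  simp only [mul_add, mul_zero, coeff_add, Finsupp.add_apply, coeff_zero, Finsupp.zero_apply] at hcon
  rw [← mul_assoc, ← mul_assoc, hcomm, ← List.sum_map_mul_left] at hcon
  apply hz
  have hzero : ((List.map (fun p : MonoidAlgebra R G × MonoidAlgebra R G =>
      single g⁻¹ (1 : R) * (p.1 * single g 1 * p.2)) l).sum).coeff z = 0 := by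
    have : ∀ l' : List (MonoidAlgebra R G × MonoidAlgebra R G), (∀ p ∈ l', p ∈ l) →
        ((List.map (fun p : MonoidAlgebra R G × MonoidAlgebra R G =>
      single g⁻¹ (1 : R) * (p.1 * single g 1 * p.2)) l').sum).coeff z = 0 := by
      intro l'
      induction l' with
      | nil => intro _; simp
      | cons p l' ih =>
        intro hl'
        rw [List.map_cons, List.sum_cons, coeff_add, Finsupp.add_apply,
          ih (fun q hq => hl' q (List.mem_cons_of_mem _ hq)), add_zero]
        by_contra hne
        have hs : SuppIn {y | ∃ a ∈ p.1.coeff.support, ∃ b ∈ p.2.coeff.support,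
            g⁻¹ * a * g * b = y} (single g⁻¹ (1 : R) * (p.1 * single g 1 * p.2)) := by
          have e : single g⁻¹ (1 : R) * (p.1 * single g 1 * p.2) =
            single g⁻¹ (1 : R) * p.1 * single g 1 * p.2 := by simp only [mul_assoc]
          rw [e]
          refine SuppIn.mul (N := {y | ∃ a ∈ p.1.coeff.support, g⁻¹ * a * g = y})
            (SuppIn.mul (N := {y | ∃ a ∈ p.1.coeff.support, g⁻¹ * a = y})
              (SuppIn.mul (SuppIn.single g⁻¹) (suppIn_self p.1) ?_) (SuppIn.single g) ?_)
              (suppIn_self p.2) ?_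
          · rintro _ rfl q hq
            exact ⟨q, hq, rfl⟩
          · rintro _ ⟨a, ha, rfl⟩ _ rfl
            exact ⟨a, ha, rfl⟩
          · rintro _ ⟨a, ha, rfl⟩ b hb
            exact ⟨a, ha, b, hb, rfl⟩
        obtain ⟨a, ha, b, hb, hab⟩ := hs z hne
        refine hg2 p (hl' p List.mem_cons_self) a ha b hb ?_
        rw [← hab]; group
    exact this l (fun _ h => h)
  rw [hzero, add_zero] at hcon
  exact hcon

end ThetaPart
section SymPart

open Filter MonoidAlgebra

variable {ι : Type*} [DecidableEq ι]

/-- Symmetrized products. -/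
def symS {A : Type*} [Ring A] (x : A) (u : ι → A) : ℕ → Finset ι → A
  | 0, _ => 1
  | k + 1, T => ∑ i ∈ T, x * u i * symS x u k (T.erase i)

theorem symS_congr {A : Type*} [Ring A] (x : A) (u v : ι → A) (k : ℕ) :
    ∀ T : Finset ι, (∀ i ∈ T, u i = v i) → symS x u k T = symS x v k T := by
  induction k with
  | zero => intro T _; rfl
  | succ k ih =>
    intro T h
    simp only [symS]
    refine Finset.sum_congr rfl fun i hi => ?_
    rw [h i hi, ih (T.erase i) (fun j hj => h j (Finset.mem_of_mem_erase hj))]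

variable {G : Type*} [Group G]

/-- Words appearing in the expansion. -/
inductive SWord (X : Set G) (u : ι → G) : Finset ι → G → Prop
  | base {T : Finset ι} {b : G} (hb : b ∈ X) : SWord X u T b
  | step {T : Finset ι} {b w : G} {i : ι} (hi : i ∈ T) (hb : b ∈ X)
      (hw : SWord X u (T.erase i) w) : SWord X u T (b * u i * w)

/-- Words with at least one letter. -/
def NWord (X : Set G) (u : ι → G) (T : Finset ι) (v : G) : Prop :=
  ∃ i ∈ T, ∃ b ∈ X, ∃ w, SWord X u (T.erase i) w ∧ v = b * u i * w

theorem NWord.sword {X : Set G} {u : ι → G} {T : Finset ι} {v : G} (h : NWord X u T v) :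
    SWord X u T v := by
  obtain ⟨i, hi, b, hb, w, hw, rfl⟩ := h
  exact SWord.step hi hb hw

theorem SWord.mono {X : Set G} {u : ι → G} {T : Finset ι} {w : G} (h : SWord X u T w) :
    ∀ {T' : Finset ι}, T ⊆ T' → SWord X u T' w := by
  induction h with
  | base hb => intro T' _; exact SWord.base hb
  | step hi hb hw ih =>
    intro T' hT
    exact SWord.step (hT hi) hb (ih (Finset.erase_subset_erase _ hT))

theorem SWord.congr {X : Set G} {u v : ι → G} {T : Finset ι} {w : G} (h : SWord X u T w)
    (huv : ∀ i ∈ T, u i = v i) : SWord X v T w := by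
  induction h with
  | base hb => exact SWord.base hb
  | step hi hb hw ih =>
    rw [huv _ hi]
    exact SWord.step hi hb (ih fun j hj => huv j (Finset.mem_of_mem_erase hj))

theorem SWord.finite {X : Set G} (hX : X.Finite) (u : ι → G) (n : ℕ) :
    ∀ T : Finset ι, T.card = n → {w | SWord X u T w}.Finite := by
  induction n with
  | zero =>
    intro T hT
    rw [Finset.card_eq_zero] at hT
    subst hT
    refine hX.subset ?_
    intro w hw
    cases hw with
    | base hb => exact hb
    | step hi hb hw => exact absurd hi (Finset.notMem_empty _)
  | succ n ih =>
    intro T hT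
    have hf : (X ∪ ⋃ i ∈ T, Set.image2 (fun b w => b * u i * w) X
        {w | SWord X u (T.erase i) w}).Finite := by
      refine hX.union (Set.Finite.biUnion T.finite_toSet fun i hi => ?_)
      refine Set.Finite.image2 _ hX (ih _ ?_)
      rw [Finset.card_erase_of_mem hi, hT]; rfl
    refine hf.subset ?_
    intro w hw
    cases hw with
    | base hb => exact Or.inl hb
    | @step _ b w i hi hb hw =>
      refine Or.inr ?_
      simp only [Set.mem_iUnion]
      exact ⟨i, hi, b, hb, w, hw, rfl⟩

theorem SWord.insert_update {X : Set G} {u : ι → G} {i : ι} {g : G} (n : ℕ) :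
    ∀ (T : Finset ι), T.card = n → i ∉ T → ∀ w, SWord X (Function.update u i g) (insert i T) w →
      SWord X u T w ∨ ∃ p q, SWord X u T p ∧ SWord X u T q ∧ w = p * g * q := by
  have hcong : ∀ T : Finset ι, i ∉ T → ∀ w, SWord X (Function.update u i g) T w → SWord X u T w := by
    intro T hT w hw
    refine hw.congr fun j hj => ?_
    exact Function.update_of_ne (ne_of_mem_of_not_mem hj hT) _ _
  induction n with
  | zero =>
    intro T hT hi w hw
    rw [Finset.card_eq_zero] at hT
    subst hT
    cases hw with
    | base hb => exact Or.inl (SWord.base hb)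
    | @step _ b w j hj hb hw =>
      have : j = i := by simpa using hj
      subst this
      refine Or.inr ⟨b, w, SWord.base hb, ?_, by simp⟩
      rw [Finset.erase_insert hi] at hw
      exact hcong _ hi _ hw
  | succ n ih =>
    intro T hT hi w hw
    cases hw with
    | base hb => exact Or.inl (SWord.base hb)
    | @step _ b w j hj hb hw =>
      by_cases hji : j = i
      · subst hji
        refine Or.inr ⟨b, w, SWord.base hb, ?_, by simp⟩
        rw [Finset.erase_insert hi] at hw
        exact hcong _ hi _ hw
      · have hjT : j ∈ T := (Finset.mem_insert.mp hj).resolve_left hji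
        rw [Finset.erase_insert_of_ne (Ne.symm hji)] at hw
        have hc : (T.erase j).card = n := by
          rw [Finset.card_erase_of_mem hjT, hT]; rfl
        rw [Function.update_of_ne hji]
        rcases ih (T.erase j) hc (fun h => hi (Finset.mem_of_mem_erase h)) w hw with h | ⟨p, q, hp, hq, rfl⟩
        · exact Or.inl (SWord.step hjT hb h)
        · refine Or.inr ⟨b * u j * p, q, SWord.step hjT hb hp, hq.mono (Finset.erase_subset _ _), ?_⟩
          group

theorem NWord.insert_update {X : Set G} {u : ι → G} {i : ι} {g : G}
    (T : Finset ι) (hi : i ∉ T) (v : G) (h : NWord X (Function.update u i g) (insert i T) v) :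
      NWord X u T v ∨ ∃ p q, SWord X u T p ∧ SWord X u T q ∧ v = p * g * q := by
  obtain ⟨j, hj, b, hb, w, hw, rfl⟩ := h
  by_cases hji : j = i
  · subst hji
    refine Or.inr ⟨b, w, SWord.base hb, ?_, by simp⟩
    rw [Finset.erase_insert hi] at hw
    refine hw.congr fun k hk => ?_
    exact Function.update_of_ne (ne_of_mem_of_not_mem hk hi) _ _
  · have hjT : j ∈ T := (Finset.mem_insert.mp hj).resolve_left hji
    rw [Finset.erase_insert_of_ne (Ne.symm hji)] at hw
    rw [Function.update_of_ne hji]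
    rcases SWord.insert_update _ (T.erase j) rfl (fun h => hi (Finset.mem_of_mem_erase h)) w hw
      with h | ⟨p, q, hp, hq, rfl⟩
    · exact Or.inl ⟨j, hjT, b, hb, w, h, rfl⟩
    · refine Or.inr ⟨b * u j * p, q, SWord.step hjT hb hp, hq.mono (Finset.erase_subset _ _), ?_⟩
      group

/-- Generic assignments. -/
def SGeneric (X : Set G) (E : Finset G) (T : Finset ι) (u : ι → G) : Prop :=
  ∀ v, NWord X u T v → ∀ e ∈ E, v * e ∉ FCSubgroup G

theorem SGeneric.eventually {X : Set G} (hX : X.Finite) (hG : ¬ (FCSubgroup G).FiniteIndex)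
    {E : Finset G} {T : Finset ι} {u : ι → G} (h : SGeneric X E T u) {i : ι} (hi : i ∉ T) :
    ∀ᶠ g in coSmall G, SGeneric X E (insert i T) (Function.update u i g) := by
  have hfin := SWord.finite hX u _ T rfl
  have h1 : ∀ᶠ g in coSmall G, ∀ p ∈ {w | SWord X u T w}, ∀ q ∈ {w | SWord X u T w}, ∀ e ∈ E,
      p * g * (q * e) ∉ FCSubgroup G := by
    rw [Filter.eventually_all_finite hfin]
    intro p _
    rw [Filter.eventually_all_finite hfin]
    intro q _
    rw [Filter.eventually_all_finset]
    intro e _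
    exact coSmall_mul_notin hG _ _
  filter_upwards [h1] with g hg v hv e he
  rcases NWord.insert_update T hi v hv with h2 | ⟨p, q, hp, hq, rfl⟩
  · exact h v h2 e he
  · have := hg p hp q hq e he
    rwa [← mul_assoc] at this

variable {R : Type*} [CommRing R]

theorem symS_linForm (x : MonoidAlgebra R G) {X : Set G} (hX : SuppIn X x) (u : ι → G) (i : ι) (k : ℕ) :
    ∀ T : Finset ι, T.card = k → i ∉ T →
      ∃ f : G → MonoidAlgebra R G, LinForm {v | NWord X u T v} f ∧ ∀ g,
        symS x (fun j => single (Function.update u i g j) (1 : R)) (k + 1) (insert i T) =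
          x * single g 1 * symS x (fun j => single (u j) (1 : R)) k T + f g := by
  induction k with
  | zero =>
    intro T hT hi
    rw [Finset.card_eq_zero] at hT
    subst hT
    exact ⟨_, LinForm.zero _, fun g => by simp [symS]⟩
  | succ k ih =>
    intro T hT hi
    have : ∀ j : ι, ∃ f : G → MonoidAlgebra R G, j ∈ T →
        (LinForm {v | NWord X u (T.erase j) v} f ∧ ∀ g,
        symS x (fun j => single (Function.update u i g j) (1 : R)) (k + 1) (insert i (T.erase j)) =
          x * single g 1 * symS x (fun j => single (u j) (1 : R)) k (T.erase j) + f g) := by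
      intro j
      by_cases hj : j ∈ T
      · obtain ⟨f, hf⟩ := ih (T.erase j) (by rw [Finset.card_erase_of_mem hj, hT]; rfl)
          (fun h => hi (Finset.mem_of_mem_erase h))
        exact ⟨f, fun _ => hf⟩
      · exact ⟨0, fun h => absurd h hj⟩
    choose f hf using this
    refine ⟨fun g => ∑ j ∈ T, (x * single (u j) 1 * x * single g 1 *
      symS x (fun j => single (u j) (1 : R)) k (T.erase j) + x * single (u j) 1 * f j g), ?_, ?_⟩
    · apply LinForm.sum
      intro j hj
      apply LinForm.add
      · apply LinForm.basic
        refine SuppIn.mul (SuppIn.mul (K := {y | ∃ b ∈ X, y = b * u j}) hX (SuppIn.single (u j)) ?_) hX ?_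
        · intro p hp q hq
          rw [Set.mem_singleton_iff.mp hq]
          exact ⟨p, hp, rfl⟩
        · rintro _ ⟨b, hb, rfl⟩ q hq
          exact ⟨j, hj, b, hb, q, SWord.base hq, rfl⟩
      · refine LinForm.mul_left (hf j hj).1
          (SuppIn.mul (K := {y | ∃ b ∈ X, y = b * u j}) hX (SuppIn.single (u j)) ?_) ?_
        · intro p hp q hq
          rw [Set.mem_singleton_iff.mp hq]
          exact ⟨p, hp, rfl⟩
        · rintro _ ⟨b, hb, rfl⟩ q hq
          exact ⟨j, hj, b, hb, q, NWord.sword hq, rfl⟩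
    · intro g
      rw [symS, Finset.sum_insert hi, Finset.erase_insert hi, Function.update_self]
      congr 1
      · congr 1
        apply symS_congr
        intro j hj
        rw [Function.update_of_ne (ne_of_mem_of_not_mem hj hi)]
      · refine Finset.sum_congr rfl fun j hj => ?_
        have hji : j ≠ i := fun h => hi (h ▸ hj)
        rw [Finset.erase_insert_of_ne (Ne.symm hji), (hf j hj).2 g, Function.update_of_ne hji, mul_add]
        simp only [mul_assoc]

theorem symS_main (hG : ¬ (FCSubgroup G).FiniteIndex) (x : MonoidAlgebra R G) :
    ∀ l : List ι, l.Nodup → ∀ y : MonoidAlgebra R G,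
      (∃ E : Finset G, ∀ u : ι → G, SGeneric (x.coeff.support : Set G) E l.toFinset u →
        y * symS x (fun j => single (u j) (1 : R)) l.length l.toFinset = 0) →
      ∀ u : ι → G, y * (l.map (fun i => x * single (u i) (1 : R))).prod = 0 := by
  classical
  intro l
  induction l with
  | nil =>
    rintro _ y ⟨E, hE⟩ u
    have := hE u (by
      rintro v ⟨i, hi, _⟩
      simp at hi)
    simpa [symS] using this
  | cons i l ih =>
    rintro hnd y ⟨E, hE⟩ u0
    obtain ⟨hil, hnd⟩ := List.nodup_cons.mp hnd
    have hiT : i ∉ l.toFinset := by simpa using hil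
    rw [List.map_cons, List.prod_cons, ← mul_assoc]
    refine mul_eq_zero_of_theta (FCSubgroup G) _ _ _ rfl ?_
    intro t
    set s := u0 i with hs
    refine ih hnd _ ⟨E ∪ (single t (1 : R) * y).coeff.support.image (fun a => s * a), ?_⟩ u0
    intro u hu
    obtain ⟨f, hf, hfg⟩ := symS_linForm x (suppIn_self x) u i l.length l.toFinset
      (List.toFinset_card_of_nodup hnd) hiT
    have huE : SGeneric (x.coeff.support : Set G) E l.toFinset u := fun v hv e he =>
      hu v hv e (Finset.mem_union_left _ he)
    have hev := coSmall_translate s (SGeneric.eventually (Finset.finite_toSet _) hG huE hiT)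
    refine delta_lemma (N := {z | ∃ a ∈ (single t (1 : R) * y).coeff.support, ∃ v,
      NWord (x.coeff.support : Set G) u l.toFinset v ∧ z = a * v * s})
      (f := fun g => (single t (1 : R) * y) * f (s * g)) ?_ _ _ ?_ ?_
    · rintro _ ⟨a, ha, v, hv, rfl⟩ hmem
      refine hu v hv (s * a) (Finset.mem_union_right _ (Finset.mem_image_of_mem _ ha)) ?_
      have := (fcNormal G).conj_mem _ hmem a⁻¹
      convert this using 1
      group
    · refine LinForm.mul_left (N := {z | ∃ v, NWord (x.coeff.support : Set G) u l.toFinset v ∧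
        z = v * s}) (hf.translate s ?_) (suppIn_self _) ?_
      · intro p hp
        exact ⟨p, hp, rfl⟩
      · rintro p hp _ ⟨v, hv, rfl⟩
        exact ⟨p, hp, v, hv, by group⟩
    · filter_upwards [hev] with g hg
      have h1 := hE (Function.update u i (s * g)) (by simpa using hg)
      rw [List.length_cons, List.toFinset_cons, hfg (s * g)] at h1
      have h2 : single (s * g) (1 : R) = single s 1 * single g 1 := by
        rw [single_mul_single, one_mul]
      calc _ = single t (1 : R) * (y * (x * single (s * g) 1 *
          symS x (fun j => single (u j) (1 : R)) l.length l.toFinset + f (s * g))) := by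
            rw [h2, mul_add, mul_add]
            simp only [mul_assoc]
        _ = 0 := by rw [h1, mul_zero]

theorem symS_fin (hG : ¬ (FCSubgroup G).FiniteIndex) (x : MonoidAlgebra R G) (n : ℕ)
    (h : ∀ u : Fin n → G, symS x (fun j => single (u j) (1 : R)) n Finset.univ = 0)
    (u : Fin n → G) : (List.ofFn (fun i => x * single (u i) (1 : R))).prod = 0 := by
  have hT : (List.finRange n).toFinset = Finset.univ := by
    ext i; simp
  have := symS_main hG x (List.finRange n) (List.nodup_finRange n) 1 ⟨∅, fun u _ => by
    rw [hT, List.length_finRange, h u, mul_zero]⟩ u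
  rwa [one_mul, ← List.ofFn_eq_map] at this

end SymPart
section TransferPart

open Filter MonoidAlgebra

variable {R : Type*} [CommRing R] {G : Type*} [Group G]

theorem map_symS {ι : Type*} [DecidableEq ι] {A B : Type*} [Ring A] [Ring B] (φ : A →+* B) (x : A)
    (u : ι → A) (k : ℕ) : ∀ T : Finset ι, φ (symS x u k T) = symS (φ x) (fun i => φ (u i)) k T := by
  induction k with
  | zero => intro T; simp [symS]
  | succ k ih =>
    intro T
    simp only [symS, map_sum, map_mul, ih]

/-- Germs along the hyperfilter. -/
abbrev HGerm (G : Type*) := (hyperfilter ℕ : Filter ℕ).Germ G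

/-- The scalars into germs of the group algebra. -/
noncomputable def germScalar (R : Type*) [CommRing R] (G : Type*) [Group G] :
    R →+* HGerm (MonoidAlgebra R G) :=
  ((Germ.coeRingHom (hyperfilter ℕ : Filter ℕ)).comp
    (Pi.constRingHom ℕ (MonoidAlgebra R G))).comp (algebraMap R (MonoidAlgebra R G))

/-- Germs of group elements into germs of the group algebra. -/
noncomputable def germOf (R : Type*) [CommRing R] (G : Type*) [Group G] :
    HGerm G →* HGerm (MonoidAlgebra R G) where
  toFun := Germ.map (fun g => single g (1 : R))
  map_one' := rfl
  map_mul' := by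
    intro a b
    induction a using Germ.inductionOn with
    | _ a =>
      induction b using Germ.inductionOn with
      | _ b =>
        refine congrArg (Germ.ofFun) ?_
        funext n
        show single (a n * b n) (1 : R) = single (a n) 1 * single (b n) 1
        rw [single_mul_single, one_mul]

theorem germ_commute (r : R) (g : HGerm G) : Commute (germScalar R G r) (germOf R G g) := by
  induction g using Germ.inductionOn with
  | _ g =>
    refine congrArg (Germ.ofFun) ?_
    funext n
    exact Algebra.commutes r (single (g n) (1 : R))

/-- The comparison map. -/
noncomputable def germPhi (R : Type*) [CommRing R] (G : Type*) [Group G] :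
    MonoidAlgebra R (HGerm G) →+* HGerm (MonoidAlgebra R G) :=
  liftNCRingHom (germScalar R G) (germOf R G) germ_commute

theorem germPhi_single (a : ℕ → G) (r : R) :
    germPhi R G (single (a : HGerm G) r) = ((fun n => single (a n) r : ℕ → MonoidAlgebra R G) :
      HGerm (MonoidAlgebra R G)) := by
  rw [germPhi, liftNCRingHom_single]
  refine congrArg (Germ.ofFun) ?_
  funext n
  show algebraMap R (MonoidAlgebra R G) r * single (a n) (1 : R) = single (a n) r
  rw [← Algebra.smul_def, smul_single, smul_eq_mul, mul_one]

theorem germPhi_injective : Function.Injective (germPhi R G) := by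
  classical
  rw [injective_iff_map_eq_zero]
  intro z hz
  have hout : ∀ s : HGerm G, ∃ a : ℕ → G, (a : HGerm G) = s := fun s => by
    induction s using Germ.inductionOn with
    | _ s => exact ⟨s, rfl⟩
  choose a ha using hout
  have h1 : germPhi R G z = Germ.coeRingHom (hyperfilter ℕ : Filter ℕ)
      (∑ s ∈ z.coeff.support, fun n => single (a s n) (z.coeff s)) := by
    conv_lhs => rw [← sum_coeff_single z]
    rw [Finsupp.sum, map_sum, map_sum]
    refine Finset.sum_congr rfl fun s _ => ?_
    conv_lhs => rw [← ha s]
    rw [germPhi_single, ha s]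
    rfl
  rw [hz] at h1
  have h2 : ∀ᶠ n in (hyperfilter ℕ : Filter ℕ),
      (0 : MonoidAlgebra R G) = ∑ s ∈ z.coeff.support, single (a s n) (z.coeff s) := by
    have := Germ.coe_eq.mp (h1 : ((0 : ℕ → MonoidAlgebra R G) : HGerm (MonoidAlgebra R G)) = _)
    filter_upwards [this] with n hn
    simpa using hn
  have h3 : ∀ᶠ n in (hyperfilter ℕ : Filter ℕ), ∀ s ∈ z.coeff.support, ∀ t ∈ z.coeff.support,
      a s n = a t n → s = t := by
    rw [Filter.eventually_all_finset]
    intro s _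
    rw [Filter.eventually_all_finset]
    intro t _
    by_cases hst : s = t
    · exact Eventually.of_forall fun _ _ => hst
    · have : ¬ ∀ᶠ n in (hyperfilter ℕ : Filter ℕ), a s n = a t n := by
        intro h
        apply hst
        rw [← ha s, ← ha t]
        exact Germ.coe_eq.mpr h
      rw [← Ultrafilter.eventually_not] at this
      filter_upwards [this] with n hn h
      exact absurd h hn
  obtain ⟨n, hn2, hn3⟩ := (h2.and h3).exists
  by_contra hz0
  have : z.coeff.support.Nonempty := by
    rw [Finsupp.support_nonempty_iff]
    simpa using hz0
  obtain ⟨s, hs⟩ := this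
  have h4 := congrArg (fun y => y.coeff (a s n)) hn2
  simp only [coeff_zero, Finsupp.zero_apply, coeff_sum, Finsupp.finset_sum_apply] at h4
  rw [Finset.sum_eq_single s] at h4
  · rw [coeff_single, Finsupp.single_eq_same] at h4
    exact Finsupp.mem_support_iff.mp hs h4.symm
  · intro t ht hts
    rw [coeff_single, Finsupp.single_apply, if_neg]
    exact fun h => hts (hn3 t ht s hs h)
  · exact fun h => absurd hs h

/-- The constant germs. -/
noncomputable def germConst (G : Type*) [Group G] : G →* HGerm G where
  toFun := fun g => ((fun _ => g : ℕ → G) : HGerm G)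
  map_one' := rfl
  map_mul' := fun _ _ => rfl

theorem germConst_injective : Function.Injective (germConst G) := by
  intro g h hgh
  have := Germ.coe_eq.mp (hgh : ((fun _ => g : ℕ → G) : HGerm G) = ((fun _ => h : ℕ → G) : HGerm G))
  exact this.exists.choose_spec

theorem germPhi_mapDomain (x : MonoidAlgebra R G) :
    germPhi R G (mapDomainRingHom R (germConst G) x) =
      ((fun _ => x : ℕ → MonoidAlgebra R G) : HGerm (MonoidAlgebra R G)) := by
  induction x using MonoidAlgebra.induction_linear with
  | zero => rw [map_zero, map_zero]; rfl
  | add x y hx hy => rw [map_add, map_add, hx, hy]; rfl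
  | single g r =>
    have : mapDomainRingHom R (germConst G) (single g r) =
        single ((fun _ => g : ℕ → G) : HGerm G) r := mapDomain_single
    rw [this, germPhi_single]

theorem symS_transfer (hG : ¬ (FCSubgroup (HGerm G)).FiniteIndex) (x : MonoidAlgebra R G) (n : ℕ)
    (h : ∀ u : Fin n → MonoidAlgebra R G, symS x u n Finset.univ = 0)
    (u : Fin n → G) : (List.ofFn (fun i => x * single (u i) (1 : R))).prod = 0 := by
  set ψ := mapDomainRingHom R (germConst G) with hψ
  have hψi : Function.Injective ψ := mapDomain_injective germConst_injective
  apply hψi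
  rw [map_zero, map_list_prod, List.map_ofFn]
  have key := symS_fin hG (ψ x) n ?_ (fun i => germConst G (u i))
  · rw [← key]
    congr 1
    congr 1
    funext i
    simp only [Function.comp, map_mul]
    congr 1
    exact mapDomain_single
  · intro v
    have hout : ∀ i, ∃ a : ℕ → G, (a : HGerm G) = v i := fun i => by
      induction v i using Germ.inductionOn with
      | _ s => exact ⟨s, rfl⟩
    choose a ha using hout
    apply germPhi_injective
    rw [map_symS, map_zero, germPhi_mapDomain]
    have e : (fun i => germPhi R G (single (v i) (1 : R))) = fun i =>
        Germ.coeRingHom (hyperfilter ℕ : Filter ℕ) (fun m => single (a i m) (1 : R)) := by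
      funext i
      rw [← ha i, germPhi_single]
      rfl
    rw [e]
    have e2 := map_symS (Germ.coeRingHom (hyperfilter ℕ : Filter ℕ)) (fun _ : ℕ => x)
      (fun i : Fin n => fun m => single (a i m) (1 : R)) n Finset.univ
    refine e2.symm.trans ?_
    have e3 : symS (fun _ : ℕ => x) (fun i : Fin n => fun m => single (a i m) (1 : R)) n
        Finset.univ = 0 := by
      funext m
      have := map_symS (Pi.evalRingHom (fun _ : ℕ => MonoidAlgebra R G) m) (fun _ : ℕ => x)
        (fun i : Fin n => fun m => single (a i m) (1 : R)) n Finset.univ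
      exact this.trans (h _)
    rw [e3, map_zero]

theorem prod_zero_extend (x : MonoidAlgebra R G) (n : ℕ) : ∀ y : MonoidAlgebra R G,
    (∀ u : Fin n → G, y * (List.ofFn (fun i => x * single (u i) (1 : R))).prod = 0) →
    ∀ u : Fin n → MonoidAlgebra R G, y * (List.ofFn (fun i => x * u i)).prod = 0 := by
  induction n with
  | zero => intro y h u; simpa using h (fun i => 1)
  | succ n ih =>
    intro y h u
    rw [List.ofFn_succ, List.prod_cons]
    generalize u 0 = z
    induction z using MonoidAlgebra.induction_linear with
    | zero => simp
    | add a b ha hb => rw [mul_add, add_mul, mul_add, ha, hb, add_zero]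
    | single g r =>
      have h1 := ih (y * (x * single g (1 : R))) (fun v => by
        have := h (Fin.cons g v)
        rw [List.ofFn_succ, List.prod_cons] at this
        simpa [mul_assoc] using this) (fun i => u i.succ)
      have h2 : single g r = r • single g (1 : R) := by
        rw [smul_single, smul_eq_mul, mul_one]
      rw [h2, mul_smul_comm, smul_mul_assoc, mul_smul_comm, ← mul_assoc, h1, smul_zero]

end TransferPart
section PolyPart

open Polynomial

/-- Alternating sums of powers. -/
def altE {ι : Type*} [DecidableEq ι] {A : Type*} [Ring A] (x : A) (u : ι → A) (k : ℕ)
    (T : Finset ι) (w : A) : A :=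
  ∑ s ∈ T.powerset, ((-1 : ℤ) ^ (T.card + s.card)) • (x * (w + ∑ i ∈ s, u i)) ^ k

theorem altE_succ {ι : Type*} [DecidableEq ι] {A : Type*} [Ring A] (x : A) (u : ι → A) (k : ℕ)
    (T : Finset ι) (w : A) :
    altE x u (k + 1) T w = x * w * altE x u k T w +
      ∑ i ∈ T, x * u i * altE x u k (T.erase i) (w + u i) := by
  have h1 : altE x u (k + 1) T w = x * w * altE x u k T w +
      ∑ s ∈ T.powerset, ∑ i ∈ s, x * u i *
        (((-1 : ℤ) ^ (T.card + s.card)) • (x * (w + ∑ i ∈ s, u i)) ^ k) := by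
    rw [altE, altE, Finset.mul_sum, ← Finset.sum_add_distrib]
    refine Finset.sum_congr rfl fun s _ => ?_
    rw [← Finset.sum_mul, ← Finset.mul_sum, ← add_mul, ← mul_add, pow_succ', mul_smul_comm]
  rw [h1]
  congr 1
  rw [Finset.sum_comm' (t' := T) (s' := fun i => T.powerset.filter (fun s => i ∈ s))]
  swap
  · intro s i
    simp only [Finset.mem_powerset, Finset.mem_filter]
    constructor
    · rintro ⟨h, h'⟩
      exact ⟨⟨h, h'⟩, h h'⟩
    · rintro ⟨⟨h, h'⟩, _⟩
      exact ⟨h, h'⟩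
  refine Finset.sum_congr rfl fun i hi => ?_
  rw [← Finset.mul_sum]
  congr 1
  rw [altE]
  refine Finset.sum_nbij' (fun s => s.erase i) (fun s => insert i s) ?_ ?_ ?_ ?_ ?_
  · intro s hs
    simp only [Finset.mem_powerset, Finset.mem_filter] at hs ⊢
    exact Finset.erase_subset_erase _ hs.1
  · intro s hs
    simp only [Finset.mem_powerset, Finset.mem_filter] at hs ⊢
    exact ⟨Finset.insert_subset hi (hs.trans (Finset.erase_subset _ _)), Finset.mem_insert_self _ _⟩
  · intro s hs
    simp only [Finset.mem_powerset, Finset.mem_filter] at hs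
    exact Finset.insert_erase hs.2
  · intro s hs
    simp only [Finset.mem_powerset] at hs
    exact Finset.erase_insert (fun h => Finset.notMem_erase i T (hs h))
  · intro s hs
    simp only [Finset.mem_powerset, Finset.mem_filter] at hs
    have c1 := Finset.card_erase_add_one hi
    have c2 := Finset.card_erase_add_one hs.2
    rw [← c1, ← c2, ← Finset.add_sum_erase s u hs.2, ← add_assoc w]
    congr 1
    ring

theorem altE_eq {ι : Type*} [DecidableEq ι] {A : Type*} [Ring A] (x : A) (u : ι → A) (k : ℕ) :
    ∀ (T : Finset ι) (w : A), (k < T.card → altE x u k T w = 0) ∧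
      (T.card = k → altE x u k T w = symS x u k T) := by
  induction k with
  | zero =>
    intro T w
    constructor
    · intro hT
      have hne : T.Nonempty := Finset.card_pos.mp hT
      have := Finset.sum_powerset_neg_one_pow_card_of_nonempty hne
      simp only [altE, pow_zero, pow_add, ← Finset.sum_smul, ← Finset.mul_sum, this, mul_zero, zero_smul]
    · intro hT
      rw [Finset.card_eq_zero] at hT
      subst hT
      simp [altE, symS]
  | succ k ih =>
    intro T w
    constructor
    · intro hT
      rw [altE_succ, (ih T w).1 (by omega), mul_zero, zero_add]
      refine Finset.sum_eq_zero fun i hi => ?_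
      rw [(ih (T.erase i) _).1 (by rw [Finset.card_erase_of_mem hi]; omega), mul_zero]
    · intro hT
      rw [altE_succ, (ih T w).1 (by omega), mul_zero, zero_add, symS]
      refine Finset.sum_congr rfl fun i hi => ?_
      rw [(ih (T.erase i) _).2 (by rw [Finset.card_erase_of_mem hi]; omega)]

variable {R : Type*} [CommRing R]

theorem symS_of_poly {A : Type*} [Ring A] [Algebra R A] (H : R[X]) (x : A)
    (h : ∀ u : A, aeval (x * u) H = 0) (u : Fin H.natDegree → A) :
    H.leadingCoeff • symS x u H.natDegree Finset.univ = 0 := by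
  have h1 : ∑ s ∈ (Finset.univ : Finset (Fin H.natDegree)).powerset,
      ((-1 : ℤ) ^ ((Finset.univ : Finset (Fin H.natDegree)).card + s.card)) •
        aeval (x * (0 + ∑ i ∈ s, u i)) H = 0 :=
    Finset.sum_eq_zero fun s _ => by rw [h, smul_zero]
  simp only [aeval_eq_sum_range, Finset.smul_sum] at h1
  rw [Finset.sum_comm] at h1
  have h2 : ∀ k, ∑ s ∈ (Finset.univ : Finset (Fin H.natDegree)).powerset,
      ((-1 : ℤ) ^ ((Finset.univ : Finset (Fin H.natDegree)).card + s.card)) •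
        H.coeff k • (x * (0 + ∑ i ∈ s, u i)) ^ k = H.coeff k • altE x u k Finset.univ 0 := by
    intro k
    rw [altE, Finset.smul_sum]
    refine Finset.sum_congr rfl fun s _ => ?_
    rw [smul_comm]
  simp only [h2] at h1
  rw [Finset.sum_range_succ, Finset.sum_eq_zero, zero_add,
    (altE_eq x u H.natDegree Finset.univ 0).2 (by simp)] at h1
  · exact h1
  · intro k hk
    rw [(altE_eq x u k Finset.univ 0).1 (by simpa using hk), smul_zero]

/-- The auxiliary polynomials. -/
noncomputable def pq (R : Type*) [CommRing R] : ℕ → R[X] × R[X]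
  | 0 => (1, 0)
  | k + 1 => ((pq R k).1 + ((pq R k).1 + (pq R k).2) * X, (pq R k).1 + (pq R k).2)

theorem pq_coeff (k : ℕ) : (∀ j, k < j → (pq R k).1.coeff j = 0) ∧ (pq R k).1.coeff k = 1 ∧
    (∀ j, k ≤ j → (pq R k).2.coeff j = 0) := by
  induction k with
  | zero =>
    refine ⟨fun j hj => ?_, ?_, ?_⟩
    · simp only [pq, coeff_one]
      rw [if_neg (by omega)]
    · simp [pq]
    · simp [pq]
  | succ k ih =>
    obtain ⟨h1, h2, h3⟩ := ih
    refine ⟨fun j hj => ?_, ?_, fun j hj => ?_⟩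
    · obtain ⟨j, rfl⟩ : ∃ i, j = i + 1 := ⟨j - 1, by omega⟩
      simp only [pq, coeff_add, coeff_mul_X]
      rw [h1 _ (by omega), h1 _ (by omega), h3 _ (by omega)]
      simp
    · simp only [pq, coeff_add, coeff_mul_X]
      rw [h1 _ (by omega), h2, h3 _ le_rfl]
      simp
    · simp only [pq, coeff_add]
      rw [h1 _ (by omega), h3 _ (by omega), add_zero]

theorem pq_eval {A : Type*} [Ring A] [Algebra R A] (a d : A) (ha : a * a = 0) (hd : d * d = 0)
    (k : ℕ) : d * ((1 + a) * (1 + d)) ^ k =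
      aeval (d * a) (pq R k).1 * d + aeval (d * a) (pq R k).2 * (d * a) := by
  induction k with
  | zero => simp [pq]
  | succ k ih =>
    rw [pow_succ, ← mul_assoc, ih]
    set t := d * a with ht
    have e1 : d * ((1 + a) * (1 + d)) = d + t * d + t := by
      rw [ht]
      calc d * ((1 + a) * (1 + d)) = d + d * d + d * a + d * a * d := by noncomm_ring
        _ = _ := by rw [hd]; noncomm_ring
    have e2 : t * ((1 + a) * (1 + d)) = t + t * d := by
      rw [ht]
      calc d * a * ((1 + a) * (1 + d)) = d * a + d * a * d + d * (a * a) * (1 + d) := by noncomm_ring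
        _ = _ := by rw [ha]; noncomm_ring
    rw [add_mul, mul_assoc, mul_assoc, e1, e2]
    simp only [pq, map_add, map_mul, aeval_X]
    noncomm_ring

/-- The polynomial extracted from a polynomial identity of units. -/
noncomputable def gPoly (f : R[X]) : R[X] := f.sum fun k r => C r * (pq R k).1

theorem gPoly_ne_zero (f : R[X]) (hf : f ≠ 0) : gPoly f ≠ 0 := by
  intro h
  have h1 := congrArg (fun p => p.coeff f.natDegree) h
  simp only [gPoly, Polynomial.sum, finset_sum_coeff, coeff_C_mul, coeff_zero] at h1
  rw [Finset.sum_eq_single f.natDegree] at h1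
  · rw [(pq_coeff _).2.1, mul_one] at h1
    exact hf (leadingCoeff_eq_zero.mp h1)
  · intro k hk hne
    rw [(pq_coeff k).1 _ (lt_of_le_of_ne (le_natDegree_of_mem_supp k hk) hne), mul_zero]
  · intro hn
    rw [notMem_support_iff.mp hn, zero_mul]

theorem aeval_shift {A : Type*} [Ring A] [Algebra R A] (y z : A) (h : R[X]) :
    y * aeval (z * y) h * z = aeval (y * z) (X * h) := by
  rw [map_mul, aeval_X]
  induction h using Polynomial.induction_on' with
  | add p q hp hq => rw [map_add, map_add, mul_add, add_mul, hp, hq, mul_add]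
  | monomial n r =>
    rw [aeval_monomial, aeval_monomial]
    have : ∀ n : ℕ, y * (z * y) ^ n * z = y * z * (y * z) ^ n := by
      intro n
      induction n with
      | zero => simp
      | succ n ih =>
        rw [pow_succ', pow_succ', ← ih]
        have := ih
        calc y * (z * y * (z * y) ^ n) * z = y * z * (y * (z * y) ^ n * z) := by simp only [mul_assoc]
          _ = _ := by rfl
    rw [← Algebra.smul_def, ← Algebra.smul_def, mul_smul_comm, smul_mul_assoc, mul_smul_comm, this]

theorem unit_poly {A : Type*} [Ring A] [Algebra R A] (f : R[X]) (hf : ∀ v : Aˣ, aeval (v : A) f = 0)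
    (a b c : A) (ha : a ^ 2 = 0) (hbc : b * c = 0) (u : A) :
    aeval (b * a * c * u) (X * (gPoly f * X)) = 0 := by
  have ha' : a * a = 0 := by rw [← sq, ha]
  set d := c * u * b with hd
  have hdd : d * d = 0 := by
    calc d * d = c * u * (b * c) * u * b := by rw [hd]; simp only [mul_assoc]
      _ = 0 := by rw [hbc]; simp
  let v1 : Aˣ := ⟨1 + a, 1 - a, by
    calc (1 + a) * (1 - a) = 1 - a * a := by noncomm_ring
      _ = 1 := by rw [ha', sub_zero], by
    calc (1 - a) * (1 + a) = 1 - a * a := by noncomm_ring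
      _ = 1 := by rw [ha', sub_zero]⟩
  let v2 : Aˣ := ⟨1 + d, 1 - d, by
    calc (1 + d) * (1 - d) = 1 - d * d := by noncomm_ring
      _ = 1 := by rw [hdd, sub_zero], by
    calc (1 - d) * (1 + d) = 1 - d * d := by noncomm_ring
      _ = 1 := by rw [hdd, sub_zero]⟩
  have h0 : aeval ((1 + a) * (1 + d)) f = 0 := hf (v1 * v2)
  have hk : ∀ k, d * ((1 + a) * (1 + d)) ^ k * a = aeval (d * a) (pq R k).1 * (d * a) := by
    intro k
    rw [pq_eval (R := R) a d ha' hdd k]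
    calc _ = aeval (d * a) (pq R k).1 * (d * a) + aeval (d * a) (pq R k).2 * d * (a * a) := by
          noncomm_ring
      _ = _ := by rw [ha', mul_zero, add_zero]
  have h1 : aeval (d * a) (gPoly f * X) = 0 := by
    have h2 : d * aeval ((1 + a) * (1 + d)) f * a = 0 := by rw [h0]; simp
    rw [aeval_def, eval₂_eq_sum, Polynomial.sum, Finset.mul_sum, Finset.sum_mul] at h2
    rw [map_mul, aeval_X, gPoly, Polynomial.sum, map_sum, Finset.sum_mul, ← h2]
    refine Finset.sum_congr rfl fun k _ => ?_
    rw [map_mul, aeval_C, mul_assoc, ← hk k, ← Algebra.smul_def, ← Algebra.smul_def, mul_smul_comm,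
      smul_mul_assoc]
  have h2 := aeval_shift (R := R) (b * a) (c * u) (gPoly f * X)
  have e1 : c * u * (b * a) = d * a := by rw [hd]; simp only [mul_assoc]
  have e2 : b * a * (c * u) = b * a * c * u := by simp only [mul_assoc]
  rw [e1, h1, e2] at h2
  rw [← h2]; simp

end PolyPart

section LaurentPart

open Polynomial

theorem exists_weights {l : ℕ} {α : Type*} (S : Finset α) (s : Fin l → α → ℤ)
    (h : ∀ w ∈ S, ∃ i, s i w ≠ 0) : ∃ k : Fin l → ℤ, ∀ w ∈ S, ∑ i, k i * s i w ≠ 0 := by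
  classical
  let Q : α → ℤ[X] := fun w => ∑ i : Fin l, C (s i w) * X ^ (i : ℕ)
  have hQ : ∀ w ∈ S, Q w ≠ 0 := by
    intro w hw h0
    obtain ⟨i, hi⟩ := h w hw
    have := congrArg (fun p => p.coeff (i : ℕ)) h0
    simp only [Q, finset_sum_coeff, coeff_C_mul, coeff_X_pow, coeff_zero] at this
    rw [Finset.sum_eq_single i] at this
    · simp at this
      exact hi this
    · intro j _ hj
      rw [if_neg, mul_zero]
      exact fun h => hj (Fin.ext h.symm)
    · simp
  have hprod : ∏ w ∈ S, Q w ≠ 0 := Finset.prod_ne_zero_iff.mpr hQ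
  obtain ⟨n, hn⟩ : ∃ n : ℤ, (∏ w ∈ S, Q w).eval n ≠ 0 := by
    by_contra hcon
    push Not at hcon
    exact hprod (Polynomial.funext (fun n => by rw [hcon n, eval_zero]))
  refine ⟨fun i => n ^ (i : ℕ), fun w hw h0 => hn ?_⟩
  rw [eval_prod]
  refine Finset.prod_eq_zero hw ?_
  rw [← h0]
  simp only [Q, eval_finset_sum, eval_mul, eval_C, eval_pow, eval_X]
  exact Finset.sum_congr rfl fun i _ => mul_comm _ _

theorem lift_zpow_expSum {l : ℕ} {U : Type*} [Group U] (v : U) (k : Fin l → ℤ)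
    (w : FreeGroup (Fin l)) :
    FreeGroup.lift (fun i => v ^ k i) w = v ^ (∑ i, k i * expSum i w) := by
  let E : FreeGroup (Fin l) →* U :=
    { toFun := fun w => v ^ (∑ i, k i * expSum i w)
      map_one' := by simp [expSum]
      map_mul' := by
        intro a b
        rw [← zpow_add, ← Finset.sum_add_distrib]
        congr 1
        refine Finset.sum_congr rfl fun i _ => ?_
        simp only [expSum, map_mul, toAdd_mul]
        ring }
  have : FreeGroup.lift (fun i => v ^ k i) = E := by
    apply FreeGroup.ext_hom
    intro j
    show _ = v ^ (∑ i, k i * expSum i (FreeGroup.of j))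
    simp [expSum]
  rw [this]
  rfl

theorem exists_poly {R : Type*} [CommRing R] {A : Type*} [Ring A] [Algebra R A] {l : ℕ}
    (P : MonoidAlgebra R (FreeGroup (Fin l))) (hP : GoodLPI P) (h : SatisfiesLPI A P) :
    ∃ f : R[X], f ≠ 0 ∧ ∀ v : Aˣ, aeval (v : A) f = 0 := by
  classical
  obtain ⟨hP1, hP2⟩ := hP
  obtain ⟨k, hk⟩ := exists_weights (P.coeff.support.erase 1) (fun i w => expSum i w)
    (fun w hw => hP2 w (Finset.mem_of_mem_erase hw) (Finset.ne_of_mem_erase hw))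
  set E : FreeGroup (Fin l) → ℤ := fun w => ∑ i, k i * expSum i w with hE
  have hE1 : E 1 = 0 := by simp [hE, expSum]
  set M : ℕ := ∑ w ∈ P.coeff.support, (E w).natAbs with hM
  have hEM : ∀ w ∈ P.coeff.support, 0 ≤ E w + M := by
    intro w hw
    have : (E w).natAbs ≤ M := Finset.single_le_sum (f := fun w => (E w).natAbs)
      (fun _ _ => Nat.zero_le _) hw
    omega
  refine ⟨∑ w ∈ P.coeff.support, monomial (E w + M).toNat (P.coeff w), ?_, ?_⟩
  · intro h0
    have := congrArg (fun p => p.coeff M) h0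
    simp only [finset_sum_coeff, coeff_monomial, coeff_zero] at this
    rw [Finset.sum_eq_single 1] at this
    · rw [hE1, if_pos (by simp)] at this
      exact hP1 this
    · intro w hw hw1
      rw [if_neg]
      intro h1
      have h2 := hEM w hw
      exact hk w (Finset.mem_erase.mpr ⟨hw1, hw⟩) (by
        show E w = 0
        omega)
    · intro h1
      exact absurd (Finsupp.mem_support_iff.mpr hP1) h1
  · intro v
    have h1 := h (fun i => v ^ k i)
    rw [lpiEval, MonoidAlgebra.lift_apply, Finsupp.sum] at h1
    rw [map_sum]
    have h2 : ∀ w ∈ P.coeff.support, aeval (v : A) (monomial (E w + M).toNat (P.coeff w)) =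
        (P.coeff w • ((Units.coeHom A).comp (FreeGroup.lift fun i => v ^ k i)) w) * (v : A) ^ M := by
      intro w hw
      rw [aeval_monomial, MonoidHom.comp_apply, lift_zpow_expSum, ← Algebra.smul_def, smul_mul_assoc]
      congr 1
      show (v : A) ^ (E w + M).toNat = ((v ^ E w : Aˣ) : A) * (v : A) ^ M
      rw [← Units.val_pow_eq_pow_val, ← Units.val_pow_eq_pow_val, ← Units.val_mul]
      congr 1
      rw [← zpow_natCast, ← zpow_natCast, ← zpow_add, Int.toNat_of_nonneg (hEM w hw)]
    rw [Finset.sum_congr rfl h2, ← Finset.sum_mul, h1, zero_mul]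

end LaurentPart

theorem smul_cancel_monoidAlgebra {R : Type*} [CommRing R] [IsDomain R] {G : Type*} [Group G]
    {r : R} (hr : r ≠ 0) {z : MonoidAlgebra R G} (h : r • z = 0) : z = 0 := by
  apply ext_coeff
  intro g
  have := congrArg (fun y => y.coeff g) h
  simp only [MonoidAlgebra.coeff_smul, Finsupp.smul_apply, MonoidAlgebra.coeff_zero,
    Finsupp.zero_apply, smul_eq_mul] at this
  exact (mul_eq_zero.mp this).resolve_left hr

/-- Let `G` be a group and `R` a commutative domain such that the unit
group of the group algebra `RG` satisfies a Laurent polynomial identity `P` as above.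
Then either there is a positive integer `d` such that for all `a, b, c ∈ RG` with
`a² = 0` and `b*c = 0` the right ideal `b*a*c*RG` is nilpotent with `d`-th power zero,
or the FC-subgroup `φ(G)` has finite index in `G` and its commutator subgroup is finite. -/
theorem stmt8 {R : Type*} [CommRing R] [IsDomain R]
    {G : Type*} [Group G]
    {l : ℕ} (P : MonoidAlgebra R (FreeGroup (Fin l)))
    (hP : GoodLPI P) (hLPI : SatisfiesLPI (MonoidAlgebra R G) P) :
    (∃ d : ℕ, 0 < d ∧
      ∀ a b c : MonoidAlgebra R G, a ^ 2 = 0 → b * c = 0 →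
        ∀ u : Fin d → MonoidAlgebra R G,
          (List.ofFn (fun i : Fin d => b * a * c * u i)).prod = 0) ∨
    ((FCSubgroup G).FiniteIndex ∧ Finite (commutator ↥(FCSubgroup G))) := by
  obtain ⟨f, hf0, hf⟩ := exists_poly P hP hLPI
  by_cases hfc : (FCSubgroup (HGerm G)).FiniteIndex
  · right
    obtain ⟨k, T, hT⟩ := cover_of_germ hfc
    exact fc_of_cover k T hT
  · left
    set H : Polynomial R := Polynomial.X * (gPoly f * Polynomial.X) with hH
    have hH0 : H ≠ 0 := mul_ne_zero Polynomial.X_ne_zero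
      (mul_ne_zero (gPoly_ne_zero f hf0) Polynomial.X_ne_zero)
    refine ⟨H.natDegree, ?_, ?_⟩
    · rw [hH, Polynomial.natDegree_mul Polynomial.X_ne_zero
        (mul_ne_zero (gPoly_ne_zero f hf0) Polynomial.X_ne_zero), Polynomial.natDegree_X]
      omega
    · intro a b c ha hbc u
      have h1 : ∀ v : Fin H.natDegree → MonoidAlgebra R G,
          symS (b * a * c) v H.natDegree Finset.univ = 0 := fun v =>
        smul_cancel_monoidAlgebra (Polynomial.leadingCoeff_ne_zero.mpr hH0)
          (symS_of_poly H (b * a * c) (fun w => unit_poly f hf a b c ha hbc w) v)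
      have h2 := prod_zero_extend (b * a * c) H.natDegree 1
        (fun v => by rw [one_mul]; exact symS_transfer hfc (b * a * c) _ h1 v) u
      rwa [one_mul] at h2
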